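/- arXiv:1412.5310 — 2 statements merged into one kernel-verified Lean document; each statement's English description precedes it below -/
import Mathlib

section
/- Let f be a coding function and I an acyclic set of its interaction graph G(f). Then any enumeration s of I (as a sequence of distinct vertices) is a reduction sequence of f, and the iterated reduction f^{-s} equals the simultaneous I-reduction f^{-I}. -/
/-- Arc `(u,i)` of the interaction graph of a coding function `f`. -/
def arcCF {V A : Type*} [DecidableEq V] (f : (V → A) → V → A) (u i : V) : Prop :=
  ∃ (x : V → A) (a : A), f (Function.update x u a) i ≠ f x i

/-- The `v`-reduction of a coding function. -/
def reduceCF {V A : Type*} [DecidableEq V] (f : (V → A) → V → A) (v : V) :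
    (V → A) → V → A :=
  fun x i => if i = v then x i else f (Function.update x v (f x v)) i

/-- `I` is an acyclic set of the relation `G` (arc `(a,b)` iff `G a b`):
the subgraph induced on `I` has no directed cycle. -/
def AcyclicIn {V : Type*} (G : V → V → Prop) (I : Set V) : Prop :=
  ∀ a ∈ I, ¬ ∃ l : List V, (∀ i ∈ l, i ∈ I) ∧ List.Chain G a (l ++ [a])

/-- `s` is a reduction sequence of `f`: each successive vertex is loopless
in the interaction graph of the current reduced coding function. -/
def IsRedSeqCF {V A : Type*} [DecidableEq V] (f : (V → A) → V → A) : List V → Prop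
  | [] => True
  | v :: t => ¬ arcCF f v v ∧ IsRedSeqCF (reduceCF f v) t

/-- The arcs of `G` with both ends in `I`. -/
def InducedArc {V : Type*} (G : V → V → Prop) (I : Set V) (u i : V) : Prop :=
  G u i ∧ u ∈ I ∧ i ∈ I

theorem exists_chain_of_transGen_inducedArc {V : Type*} {G : V → V → Prop} {I : Set V} {a b : V}
    (h : Relation.TransGen (InducedArc G I) a b) :
    ∃ l : List V, (∀ i ∈ l, i ∈ I) ∧ List.IsChain G (a :: (l ++ [b])) := by
  induction h using Relation.TransGen.head_induction_on with
  | single h => exact ⟨[], by simp, by simpa using h.1⟩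
  | @head u c h _ ih =>
    obtain ⟨l, hl, hc⟩ := ih
    exact ⟨c :: l, by simpa using ⟨h.2.2, hl⟩, by simpa using ⟨h.1, hc⟩⟩

theorem AcyclicIn.not_transGen {V : Type*} {G : V → V → Prop} {I : Set V}
    (hI : AcyclicIn G I) (a : V) : ¬ Relation.TransGen (InducedArc G I) a a := by
  intro h
  obtain ⟨_, ⟨_, ha, _⟩, _⟩ := Relation.TransGen.head'_iff.1 h
  exact hI a ha (exists_chain_of_transGen_inducedArc h)

theorem apply_update_of_not_arcCF {V A : Type*} [DecidableEq V] {f : (V → A) → V → A} {u i : V}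
    (h : ¬ arcCF f u i) (x : V → A) (a : A) : f (Function.update x u a) i = f x i := by
  by_contra hne
  exact h ⟨x, a, hne⟩

/-- An arc of the `v`-reduction avoiding `v` comes from an arc or from a path through `v`. -/
theorem arcCF_of_arcCF_reduceCF {V A : Type*} [DecidableEq V] {f : (V → A) → V → A} {u v i : V}
    (hu : u ≠ v) (hi : i ≠ v) (h : arcCF (reduceCF f v) u i) :
    arcCF f u i ∨ arcCF f u v ∧ arcCF f v i := by
  by_contra! hc
  obtain ⟨hui, hvi⟩ := hc
  obtain ⟨x, a, hne⟩ := h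
  apply hne
  simp only [reduceCF, if_neg hi]
  by_cases huv : arcCF f u v
  · simp only [apply_update_of_not_arcCF (hvi huv), apply_update_of_not_arcCF hui]
  · rw [apply_update_of_not_arcCF huv, Function.update_comm hu,
      apply_update_of_not_arcCF hui]

/-- The state `z` agrees with `x` outside `I` and is fixed by `f` on `I`. -/
def IsCumulativeState {V A : Type*} (f : (V → A) → V → A) (I : Set V) (x z : V → A) : Prop :=
  (∀ j ∉ I, z j = x j) ∧ (∀ j ∈ I, f z j = z j)

theorem reduceCF_update_self {V A : Type*} [DecidableEq V] {f : (V → A) → V → A} {v i : V}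
    (hv : ¬ arcCF f v v) (hi : i ≠ v) {z : V → A} (hz : f z v = z v) (a : A) :
    reduceCF f v (Function.update z v a) i = f z i := by
  simp [reduceCF, if_neg hi, apply_update_of_not_arcCF hv, hz]

theorem IsCumulativeState.update_reduceCF {V A : Type*} [DecidableEq V] {f : (V → A) → V → A}
    {I : Set V} {v : V} {x z : V → A} (hv : ¬ arcCF f v v) (hvI : v ∉ I)
    (hz : IsCumulativeState f (insert v I) x z) :
    IsCumulativeState (reduceCF f v) I x (Function.update z v (x v)) := by
  refine ⟨fun j hj => ?_, fun j hj => ?_⟩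
  · by_cases hjv : j = v
    · simp [hjv]
    · simpa [hjv] using hz.1 j (by simp [hjv, hj])
  · have hjv : j ≠ v := ne_of_mem_of_not_mem hj hvI
    rw [reduceCF_update_self hv hjv (hz.2 v (by simp)), Function.update_of_ne hjv]
    exact hz.2 j (by simp [hj])

theorem IsCumulativeState.of_reduceCF {V A : Type*} [DecidableEq V] {f : (V → A) → V → A}
    {I : Set V} {v : V} {x z : V → A} (hv : ¬ arcCF f v v) (hvI : v ∉ I)
    (hz : IsCumulativeState (reduceCF f v) I x z) :
    IsCumulativeState f (insert v I) x (Function.update z v (f z v)) := by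
  refine ⟨fun j hj => ?_, fun j hj => ?_⟩
  · rw [Set.mem_insert_iff, not_or] at hj
    simpa [hj.1] using hz.1 j hj.2
  · rcases Set.mem_insert_iff.1 hj with rfl | hj
    · simp [apply_update_of_not_arcCF hv]
    · have hjv : j ≠ v := ne_of_mem_of_not_mem hj hvI
      simpa [reduceCF, hjv] using hz.2 j hj

theorem existsUnique_isCumulativeState_insert {V A : Type*} [DecidableEq V]
    {f : (V → A) → V → A} {I : Set V} {v : V} {x : V → A} (hv : ¬ arcCF f v v) (hvI : v ∉ I)
    (h : ∃! z, IsCumulativeState (reduceCF f v) I x z) :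
    ∃! z, IsCumulativeState f (insert v I) x z := by
  obtain ⟨z, hz, huniq⟩ := h
  refine ⟨_, hz.of_reduceCF hv hvI, fun w hw => ?_⟩
  rw [← huniq _ (hw.update_reduceCF hv hvI), apply_update_of_not_arcCF hv, hw.2 v (by simp)]
  simp

theorem transGen_inducedArc_of_reduceCF {V A : Type*} [DecidableEq V] {f : (V → A) → V → A}
    {I : Set V} {v a b : V} (hvI : v ∉ I)
    (h : Relation.TransGen (InducedArc (arcCF (reduceCF f v)) I) a b) :
    Relation.TransGen (InducedArc (arcCF f) (insert v I)) a b := by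
  refine Relation.TransGen.closed (fun u i ⟨harc, hu, hi⟩ => ?_) a b h
  have hu' : u ∈ insert v I := Or.inr hu
  have hi' : i ∈ insert v I := Or.inr hi
  have hv' : v ∈ insert v I := Or.inl rfl
  rcases arcCF_of_arcCF_reduceCF (ne_of_mem_of_not_mem hu hvI) (ne_of_mem_of_not_mem hi hvI)
      harc with
    h | ⟨h₁, h₂⟩
  · exact .single ⟨h, hu', hi'⟩
  · exact .tail (.single ⟨h₁, hu', hv'⟩) ⟨h₂, hv', hi'⟩

theorem isRedSeqCF_and_foldl_reduceCF_eq {V A : Type*} [DecidableEq V] (s : List V)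
    (hnd : s.Nodup) (f : (V → A) → V → A)
    (hI : ∀ a, ¬ Relation.TransGen (InducedArc (arcCF f) {v | v ∈ s}) a a) :
    IsRedSeqCF f s ∧ ∀ x : V → A,
      (∃! z, IsCumulativeState f {v | v ∈ s} x z) ∧
      ∀ z, IsCumulativeState f {v | v ∈ s} x z →
        ∀ i ∉ s, List.foldl reduceCF f s x i = f z i := by
  induction s generalizing f with
  | nil =>
    refine ⟨trivial, fun x => ⟨⟨x, by simp [IsCumulativeState], fun z hz => ?_⟩,
      fun z hz i _ => ?_⟩⟩
    · exact funext fun j => hz.1 j (by simp)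
    · obtain rfl : z = x := funext fun j => hz.1 j (by simp)
      rfl
  | cons v t ih =>
    obtain ⟨hvt, hnd⟩ := List.nodup_cons.1 hnd
    have hset : {w | w ∈ v :: t} = insert v {w | w ∈ t} := by ext; simp
    rw [hset] at hI ⊢
    have hvI : v ∉ {w | w ∈ t} := hvt
    have hv : ¬ arcCF f v v := fun h => hI v (.single ⟨h, Or.inl rfl, Or.inl rfl⟩)
    obtain ⟨hred, hcum⟩ := ih hnd (reduceCF f v) fun a h =>
      hI a (transGen_inducedArc_of_reduceCF hvI h)
    refine ⟨⟨hv, hred⟩, fun x => ⟨existsUnique_isCumulativeState_insert hv hvI (hcum x).1,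
      fun z hz i hi => ?_⟩⟩
    obtain ⟨hiv, hit⟩ := not_or.1 (List.mem_cons.not.1 hi)
    rw [List.foldl_cons, (hcum x).2 _ (hz.update_reduceCF hv hvI) i hit,
      reduceCF_update_self hv hiv (hz.2 v (by simp))]

/-- If `I` is an acyclic set of `G(f)` then any enumeration `s` of `I` is a reduction
sequence of `f` and `f^{-s} = f^{-I}`.  The simultaneous `I`-reduction `f^{-I}` is
characterised via the cumulative coding function: for a state `x`, there is a unique
state `z` agreeing with `x` outside `I` and satisfying the fixed-point equations
`f z j = z j` on `I` (its `I`-part is the cumulative function `F^I(x_{-I})`), and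
on every coordinate `i ∉ I` the reduced function takes the value `f z i`. -/
theorem stmt1 {V A : Type*} [DecidableEq V] (f : (V → A) → V → A) (I : Set V)
    (hI : AcyclicIn (arcCF f) I) (s : List V) (hnd : s.Nodup)
    (hs : ∀ v, v ∈ s ↔ v ∈ I) :
    IsRedSeqCF f s ∧
    ∀ x : V → A,
      (∃! z : V → A, (∀ j ∉ I, z j = x j) ∧ (∀ j ∈ I, f z j = z j)) ∧
      (∀ z : V → A, (∀ j ∉ I, z j = x j) → (∀ j ∈ I, f z j = z j) →
        ∀ i ∉ I, List.foldl reduceCF f s x i = f z i) := by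
  obtain rfl : {v | v ∈ s} = I := Set.ext hs
  obtain ⟨hred, hcum⟩ := isRedSeqCF_and_foldl_reduceCF_eq s hnd f hI.not_transGen
  exact ⟨hred, fun x => ⟨(hcum x).1, fun z hz hfix => (hcum x).2 z ⟨hz, hfix⟩⟩⟩
end

section
/- For any digraph G, any acyclic set I of G, and any q ≥ 2, the I-reduction of the min-net of G equals the min-net of G^{-I}: min(G,q)^{-I} = min(G^{-I}, q). -/
/-- Path from `u` to `w` with all internal vertices in `I` (at least one). -/
def PathThrough {V : Type*} (G : V → V → Prop) (I : Set V) (u w : V) : Prop :=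
  ∃ l : List V, l ≠ [] ∧ l.Nodup ∧ (∀ i ∈ l, i ∈ I) ∧ List.Chain G u (l ++ [w])

/-- The simultaneous `I`-reduction of a digraph. -/
def gReduceSet {V : Type*} (G : V → V → Prop) (I : Set V) : V → V → Prop :=
  fun a b => a ∉ I ∧ b ∉ I ∧ (G a b ∨ PathThrough G I a b)

open Classical in
/-- The min-net of a digraph `G` over the alphabet `[q+1] = {0,…,q}`:
`f_i(x) = min { x_j : j ∈ in(i) }`, with the convention `min ∅ = q` (the top). -/
noncomputable def minNet {V : Type*} [Fintype V] (G : V → V → Prop) (q : ℕ) :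
    (V → Fin (q + 1)) → V → Fin (q + 1) :=
  fun x i => Finset.univ.inf fun j => if G j i then x j else ⊤

/-- Nonempty walks all of whose internal vertices lie in `P`. -/
inductive WalkThrough {V : Type*} (G : V → V → Prop) (P : Set V) : V → V → Prop
  | edge {a b : V} : G a b → WalkThrough G P a b
  | cons {a c b : V} : G a c → c ∈ P → WalkThrough G P c b → WalkThrough G P a b

namespace WalkThrough

variable {V : Type*} {G : V → V → Prop} {P Q : Set V} {a b v : V}

theorem mono (hPQ : P ⊆ Q) (h : WalkThrough G P a b) : WalkThrough G Q a b := by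
  induction h with
  | edge h => exact edge h
  | cons h hc _ ih => exact cons h (hPQ hc) ih

theorem append (h : WalkThrough G P a v) (hv : v ∈ P) (h' : WalkThrough G P v b) :
    WalkThrough G P a b := by
  induction h with
  | edge h => exact cons h hv h'
  | cons h hc _ ih => exact cons h hc (ih hv h')

theorem insert_iff : WalkThrough G (insert v P) a b ↔
    WalkThrough G P a b ∨ WalkThrough G P a v ∧ WalkThrough G P v b := by
  constructor
  · intro h
    induction h with
    | edge h => exact .inl (edge h)
    | cons h hc _ ih =>
      rcases hc with rfl | hc
      · exact .inr ⟨edge h, ih.elim id And.right⟩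
      · exact ih.imp (cons h hc) (And.imp_left (cons h hc))
  · have hP : P ⊆ insert v P := Set.subset_insert v P
    rintro (h | ⟨h, h'⟩)
    · exact h.mono hP
    · exact (h.mono hP).append (Set.mem_insert v P) (h'.mono hP)

theorem of_isChain (l : List V) (hl : ∀ i ∈ l, i ∈ P)
    (h : List.IsChain G (a :: (l ++ [b]))) : WalkThrough G P a b := by
  induction l generalizing a with
  | nil => exact edge (by simpa using h)
  | cons c l ih =>
    rw [List.cons_append, List.isChain_cons_cons] at h
    exact cons h.1 (hl c (by simp)) (ih (fun i hi => hl i (by simp [hi])) h.2)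

theorem exists_nodup (hP : AcyclicIn G P) (h : WalkThrough G P a b) :
    ∃ l : List V, l.Nodup ∧ (∀ i ∈ l, i ∈ P) ∧ List.IsChain G (a :: (l ++ [b])) := by
  induction h with
  | edge h => exact ⟨[], by simp, by simp, by simpa using h⟩
  | @cons a c b h hc _ ih =>
    obtain ⟨l, hnd, hl, hchain⟩ := ih
    refine ⟨c :: l, List.nodup_cons.2 ⟨fun hcl => ?_, hnd⟩, ?_, ?_⟩
    · obtain ⟨l₁, l₂, rfl⟩ := List.append_of_mem hcl
      refine hP c hc ⟨l₁, fun i hi => hl i (by simp [hi]), ?_⟩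
      exact hchain.prefix ⟨l₂ ++ [b], by simp⟩
    · simpa [hc] using hl
    · exact List.isChain_cons_cons.2 ⟨h, hchain⟩

end WalkThrough

theorem walkThrough_iff {V : Type*} {G : V → V → Prop} {I : Set V} (hI : AcyclicIn G I)
    {a b : V} : WalkThrough G I a b ↔ G a b ∨ PathThrough G I a b := by
  constructor
  · intro h
    obtain ⟨l, hnd, hl, hc⟩ := h.exists_nodup hI
    rcases eq_or_ne l [] with rfl | hne
    · exact .inl (by simpa using hc)
    · exact .inr ⟨l, hne, hnd, hl, hc⟩
  · rintro (h | ⟨l, -, -, hl, hc⟩)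
    · exact .edge h
    · exact .of_isChain l hl hc

/-- The `P`-reduction of `G`, with each vertex of `P` kept and given a loop as its only
in-edge, so that its min-net is the identity on the coordinates in `P`. -/
def loopedReduction {V : Type*} (G : V → V → Prop) (P : Set V) (a b : V) : Prop :=
  (b ∈ P ∧ a = b) ∨ (b ∉ P ∧ a ∉ P ∧ WalkThrough G P a b)

section MinNet

variable {V : Type*} [Fintype V] {G : V → V → Prop} {q : ℕ}

theorem le_minNet_iff {x : V → Fin (q + 1)} {i : V} {c : Fin (q + 1)} :
    c ≤ minNet G q x i ↔ ∀ j, G j i → c ≤ x j := by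
  simp only [minNet, Finset.le_inf_iff, Finset.mem_univ, true_implies]
  refine forall_congr' fun j => ?_
  split_ifs with h <;> simp [h]

theorem minNet_loopedReduction_empty :
    minNet (loopedReduction G ∅) q = minNet G q := by
  have h : loopedReduction G ∅ = G := by
    ext a b
    simp only [loopedReduction, Set.mem_empty_iff_false, false_and, not_false_eq_true,
      true_and, false_or]
    refine ⟨fun h => ?_, .edge⟩
    cases h with
    | edge h => exact h
    | cons _ hc _ => exact hc.elim
  rw [h]

theorem reduceCF_minNet_loopedReduction [DecidableEq V] {P : Set V} {v : V} (hv : v ∉ P)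
    (hw : ¬ WalkThrough G P v v) :
    reduceCF (minNet (loopedReduction G P) q) v =
      minNet (loopedReduction G (insert v P)) q := by
  funext x i
  refine eq_of_forall_le_iff fun c => ?_
  unfold reduceCF
  split_ifs with hi
  · simp [le_minNet_iff, loopedReduction, hi]
  · by_cases hiP : i ∈ P
    · simp [le_minNet_iff, loopedReduction, hiP, Function.update_of_ne hi]
    · simp only [le_minNet_iff, loopedReduction, hiP, hi, Set.mem_insert_iff, false_and,
        false_or, not_false_eq_true, true_and, or_self, WalkThrough.insert_iff, not_or]
      constructor
      · rintro h j ⟨⟨hjv, hjP⟩, hj | ⟨hj, hj'⟩⟩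
        · simpa [hjv] using h j ⟨hjP, hj⟩
        · have := h v ⟨hv, hj'⟩
          rw [Function.update_self, le_minNet_iff] at this
          exact this j (.inr ⟨hv, hjP, hj⟩)
      · rintro h j ⟨hjP, hj⟩
        by_cases hjv : j = v
        · subst hjv
          rw [Function.update_self, le_minNet_iff]
          rintro k (⟨hk, -⟩ | ⟨-, hkP, hk⟩)
          · exact absurd hk hv
          · exact h k ⟨⟨fun hkv => hw (hkv ▸ hk), hkP⟩, .inr ⟨hk, hj⟩⟩
        · rw [Function.update_of_ne hjv]
          exact h j ⟨⟨hjv, hjP⟩, .inl hj⟩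

theorem foldl_reduceCF_minNet [DecidableEq V] {I : Set V}
    (hw : ∀ P ⊆ I, ∀ v ∈ I, ¬ WalkThrough G P v v) (s : List V) (P : Set V) (hP : P ⊆ I)
    (hnd : s.Nodup) (hs : ∀ v ∈ s, v ∈ I) (hsP : ∀ v ∈ s, v ∉ P) :
    List.foldl reduceCF (minNet (loopedReduction G P) q) s =
      minNet (loopedReduction G (P ∪ {v | v ∈ s})) q := by
  induction s generalizing P with
  | nil => simp
  | cons v s ih =>
    rw [List.nodup_cons] at hnd
    have hv : v ∈ I := hs v (by simp)
    rw [List.foldl_cons, reduceCF_minNet_loopedReduction (hsP v (by simp)) (hw P hP v hv),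
      ih (insert v P) (Set.insert_subset hv hP) hnd.2 (fun u hu => hs u (by simp [hu]))]
    · congr 2
      ext u
      simp only [Set.mem_union, Set.mem_insert_iff, Set.mem_ofPred_eq, List.mem_cons]
      tauto
    · rintro u hu (rfl | huP)
      · exact hnd.1 hu
      · exact hsP u (by simp [hu]) huP

end MinNet

/-- For any digraph `G`, any acyclic set `I` of `G` and any alphabet of size at least
two, the `I`-reduction of the min-net of `G` (obtained by reducing along any
enumeration `s` of `I`) is the min-net of `G^{-I}`: on every remaining coordinate
`i ∉ I`, `min(G,q)^{-I} = min(G^{-I},q)`. -/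
theorem stmt8 {V : Type*} [Fintype V] [DecidableEq V] (G : V → V → Prop)
    (q : ℕ) (hq : 1 ≤ q) (I : Set V) (hI : AcyclicIn G I)
    (s : List V) (hnd : s.Nodup) (hs : ∀ v, v ∈ s ↔ v ∈ I) :
    ∀ (x : V → Fin (q + 1)) (i : V), i ∉ I →
      List.foldl reduceCF (minNet G q) s x i = minNet (gReduceSet G I) q x i := by
  intro x i hi
  have hw : ∀ P ⊆ I, ∀ v ∈ I, ¬ WalkThrough G P v v := by
    intro P hP v hv h
    obtain ⟨l, -, hl, hc⟩ := (h.mono hP).exists_nodup hI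
    exact hI v hv ⟨l, hl, hc⟩
  have hsI : {v | v ∈ s} = I := Set.ext hs
  have hfold := foldl_reduceCF_minNet (q := q) hw s ∅ (Set.empty_subset I) hnd
    (fun v hv => (hs v).1 hv) (by simp)
  rw [minNet_loopedReduction_empty, Set.empty_union, hsI] at hfold
  rw [hfold]
  refine eq_of_forall_le_iff fun c => ?_
  simp only [le_minNet_iff, loopedReduction, gReduceSet, hi, walkThrough_iff hI]
  simp
end
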